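/- Let S be a finite-dimensional shift-invariant ℂ-linear subspace of the space of sequences ℤ → ℂ with dim_ℂ S = s ≥ 1. Then there exists a polynomial p(z) = 1 + p₁ z + ⋯ + p_s z^s of degree exactly s with p(0) = 1 such that S = { x : ℤ → ℂ : x_t + ∑_{τ=1}^s p_τ x_{t−τ} = 0 for all t ∈ ℤ }, and this polynomial is unique among polynomials of degree s with constant term 1 having this property. -/

import Mathlib

open Finset

noncomputable section

/-- The right shift on sequences: `[Δx]_t = x_{t−1}`. -/
def shift (x : ℤ → ℂ) : ℤ → ℂ := fun t => x (t - 1)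

/-- A solution of a linear difference equation of order `s` with nonzero extreme coefficients
vanishes as soon as it vanishes at `0, …, s - 1`. -/
theorem eq_zero_of_difference_equation {s : ℕ} (hs : 1 ≤ s) {p : ℕ → ℂ} (h0 : p 0 ≠ 0)
    (hps : p s ≠ 0) {x : ℤ → ℂ}
    (hx : ∀ t : ℤ, ∑ τ ∈ Finset.range (s + 1), p τ * x (t - (τ : ℤ)) = 0)
    (hinit : ∀ k < s, x (k : ℤ) = 0) : x = 0 := by
  have window : ∀ m : ℤ, ∀ k : ℕ, k < s → x (m + k) = 0 := by
    intro m
    induction m using Int.induction_on with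
    | zero => simpa using hinit
    | succ m ih =>
      intro k hk
      rcases Nat.lt_or_ge (k + 1) s with h | h
      · have := ih (k + 1) h
        push_cast at this
        rwa [show (m : ℤ) + 1 + k = m + (k + 1) by ring]
      · have e := hx (m + s)
        rw [Finset.sum_eq_single_of_mem 0 (by simp)] at e
        · have : x (m + s) = 0 := by simpa [h0] using e
          rwa [show (m : ℤ) + 1 + k = m + s by omega]
        · intro τ hτ hne
          have hτ := Finset.mem_range.mp hτ
          rw [show (m : ℤ) + s - τ = m + ((s - τ : ℕ) : ℤ) by omega, ih _ (by omega), mul_zero]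
    | pred m ih =>
      intro k hk
      rcases k with _ | k
      · have e := hx (-m - 1 + s)
        rw [Finset.sum_eq_single_of_mem s (by simp)] at e
        · simpa [hps] using e
        · intro τ hτ hne
          have hτ := Finset.mem_range.mp hτ
          rw [show -(m : ℤ) - 1 + s - τ = -m + ((s - 1 - τ : ℕ) : ℤ) by omega,
            ih _ (by omega), mul_zero]
      · rw [show -(m : ℤ) - 1 + ((k + 1 : ℕ) : ℤ) = -m + k by push_cast; ring]
        exact ih k (by omega)
  funext t
  simpa using window t 0 hs

/-- The initial values at `0, …, s - 1` of a sequence. -/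
def initialValues (s : ℕ) : (ℤ → ℂ) →ₗ[ℂ] (Fin s → ℂ) where
  toFun x i := x ((i : ℕ) : ℤ)
  map_add' _ _ := rfl
  map_smul' _ _ := rfl

/-- The solution space of a difference equation. -/
def solutionSpace (s : ℕ) (p : ℕ → ℂ) : Submodule ℂ (ℤ → ℂ) where
  carrier := {x | ∀ t : ℤ, ∑ τ ∈ Finset.range (s + 1), p τ * x (t - (τ : ℤ)) = 0}
  zero_mem' := by simp
  add_mem' := by
    intro x y hx hy t
    simp [mul_add, Finset.sum_add_distrib, hx t, hy t]
  smul_mem' := by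
    intro c x hx t
    have := congrArg (c * ·) (hx t)
    simpa [Finset.mul_sum, mul_left_comm] using this

theorem initialValues_injective_solutionSpace {s : ℕ} (hs : 1 ≤ s) {p : ℕ → ℂ} (h0 : p 0 ≠ 0)
    (hps : p s ≠ 0) :
    Function.Injective ((initialValues s).comp (solutionSpace s p).subtype) := by
  rw [injective_iff_map_eq_zero]
  rintro ⟨x, hx⟩ h
  exact Subtype.ext (eq_zero_of_difference_equation hs h0 hps hx
    fun k hk => congrFun h ⟨k, hk⟩)

/-- An `s`-dimensional space of solutions of a difference equation of order `s` consists of all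
solutions. -/
theorem eq_solutionSpace {s : ℕ} (hs : 1 ≤ s) {p : ℕ → ℂ} (h0 : p 0 ≠ 0)
    (hps : p s ≠ 0) {S : Submodule ℂ (ℤ → ℂ)} (hdim : Module.finrank ℂ S = s)
    (hle : S ≤ solutionSpace s p) : S = solutionSpace s p := by
  have hinj := initialValues_injective_solutionSpace hs h0 hps
  have := FiniteDimensional.of_injective _ hinj
  apply Submodule.eq_of_le_of_finrank_le hle
  simpa [hdim] using LinearMap.finrank_le_finrank_of_injective hinj

/-- Every choice of initial values is realised by an element of an `s`-dimensional solution
space. -/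
theorem exists_mem_solutionSpace_initialValues_eq {s : ℕ} (hs : 1 ≤ s) {p : ℕ → ℂ} (h0 : p 0 ≠ 0)
    (hps : p s ≠ 0) (hdim : Module.finrank ℂ (solutionSpace s p) = s) (v : Fin s → ℂ) :
    ∃ x ∈ solutionSpace s p, initialValues s x = v := by
  have hinj := initialValues_injective_solutionSpace hs h0 hps
  have := FiniteDimensional.of_injective _ hinj
  obtain ⟨⟨x, hx⟩, h⟩ :=
    (LinearMap.injective_iff_surjective_of_finrank_eq_finrank (by simp [hdim])).mp hinj v
  exact ⟨x, hx, h⟩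

/-- An `s`-dimensional solution space determines its normalised difference equation. -/
theorem coeff_eq_of_solutionSpace_eq {s : ℕ} (hs : 1 ≤ s) {p q : ℕ → ℂ} (hp0 : p 0 = 1)
    (hps : p s ≠ 0) (hq0 : q 0 = 1) (hdim : Module.finrank ℂ (solutionSpace s p) = s)
    (h : solutionSpace s p = solutionSpace s q) {τ : ℕ} (hτ : τ ≤ s) : q τ = p τ := by
  rcases Nat.eq_zero_or_pos τ with rfl | hpos
  · rw [hp0, hq0]
  obtain ⟨x, hx, hv⟩ := exists_mem_solutionSpace_initialValues_eq hs (hp0 ▸ one_ne_zero) hps hdim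
    (Pi.single ⟨s - τ, by omega⟩ 1)
  have hxp := hx s
  have hxq := (h ▸ hx : x ∈ solutionSpace s q) s
  have hsub : ∑ σ ∈ Finset.range (s + 1), (q σ - p σ) * x (s - (σ : ℤ)) = 0 := by
    simp only [sub_mul, Finset.sum_sub_distrib, hxp, hxq, sub_zero]
  have hval : ∀ σ : ℕ, 0 < σ → σ ≤ s → x ((s : ℤ) - σ) = if σ = τ then 1 else 0 := by
    intro σ hσ hσs
    have := congrFun hv ⟨s - σ, by omega⟩
    simp only [initialValues, LinearMap.coe_mk, AddHom.coe_mk, Pi.single_apply, Fin.mk.injEq,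
      Nat.cast_sub hσs] at this
    rw [this]
    exact if_congr (by omega) rfl rfl
  rw [Finset.sum_eq_single_of_mem τ (by simp; omega), hval τ hpos hτ] at hsub
  · simpa [sub_eq_zero] using hsub
  · intro σ hσ hne
    have hσ := Finset.mem_range.mp hσ
    rcases Nat.eq_zero_or_pos σ with rfl | hσpos
    · simp [hp0, hq0]
    · simp [hval σ hσpos (by omega), hne]

/-- The right shift as a linear map. -/
def shiftLinearMap : (ℤ → ℂ) →ₗ[ℂ] (ℤ → ℂ) where
  toFun := shift
  map_add' _ _ := rfl
  map_smul' _ _ := rfl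

theorem shiftLinearMap_injective : Function.Injective shiftLinearMap := by
  intro x y h
  funext t
  have h : x (t + 1 - 1) = y (t + 1 - 1) := congrFun h (t + 1)
  simpa using h

theorem restrict_shift_pow_apply {S : Submodule ℂ (ℤ → ℂ)}
    (hS : ∀ x ∈ S, shiftLinearMap x ∈ S) (n : ℕ) (x : S) (t : ℤ) :
    (((shiftLinearMap.restrict hS) ^ n) x : ℤ → ℂ) t = (x : ℤ → ℂ) (t - n) := by
  induction n generalizing t with
  | zero => simp
  | succ n ih =>
    rw [pow_succ']
    change (((shiftLinearMap.restrict hS) ^ n) x : ℤ → ℂ) (t - 1) = _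
    rw [ih, show t - 1 - (n : ℤ) = t - ((n + 1 : ℕ) : ℤ) by push_cast; ring]

/-- Cayley–Hamilton for the shift on a shift-invariant space, as a difference equation. -/
theorem sum_charpoly_coeff_mul_eq_zero {S : Submodule ℂ (ℤ → ℂ)} [FiniteDimensional ℂ S]
    (hS : ∀ x ∈ S, shiftLinearMap x ∈ S) {x : ℤ → ℂ} (hx : x ∈ S) (t : ℤ) :
    ∑ τ ∈ Finset.range (Module.finrank ℂ S + 1),
      (shiftLinearMap.restrict hS).charpoly.coeff τ * x (t - (τ : ℤ)) = 0 := by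
  have h := LinearMap.aeval_self_charpoly (shiftLinearMap.restrict hS)
  rw [Polynomial.aeval_eq_sum_range, LinearMap.charpoly_natDegree] at h
  have h := congrFun (congrArg Subtype.val (LinearMap.congr_fun h ⟨x, hx⟩)) t
  simpa [LinearMap.sum_apply, restrict_shift_pow_apply] using h

theorem charpoly_restrict_shift_coeff_zero_ne_zero {S : Submodule ℂ (ℤ → ℂ)}
    [FiniteDimensional ℂ S] (hS : ∀ x ∈ S, shiftLinearMap x ∈ S) :
    (shiftLinearMap.restrict hS).charpoly.coeff 0 ≠ 0 := by
  have hinj : Function.Injective (shiftLinearMap.restrict hS) := fun x y h =>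
    Subtype.ext (shiftLinearMap_injective (congrArg Subtype.val h))
  intro h
  have hdet : LinearMap.det (shiftLinearMap.restrict hS) = 0 := by
    rw [LinearMap.det_eq_sign_charpoly_coeff, h, mul_zero]
  exact (LinearMap.bot_lt_ker_of_det_eq_zero hdet).ne' (LinearMap.ker_eq_bot.mpr hinj)

/-- Lemma (converse part): any `s`-dimensional shift-invariant subspace of sequences is the
solution set of a unique homogeneous linear difference equation of degree `s` with `p(0) = 1`. -/
theorem shift_invariant_subspace_is_solution_set_of_unique_difference_equation
    (s : ℕ) (hs : 1 ≤ s) (S : Submodule ℂ (ℤ → ℂ))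
    (hshift : ∀ x ∈ S, shift x ∈ S)
    (hdim : Module.finrank ℂ S = s) :
    ∃! p : ℕ → ℂ,
      p 0 = 1 ∧ p s ≠ 0 ∧ (∀ τ : ℕ, s < τ → p τ = 0) ∧
      (S : Set (ℤ → ℂ)) =
        {x : ℤ → ℂ | ∀ t : ℤ, ∑ τ ∈ Finset.range (s + 1), p τ * x (t - (τ : ℤ)) = 0} := by
  have : FiniteDimensional ℂ S := Module.finite_of_finrank_pos (by omega)
  set q := (shiftLinearMap.restrict hshift).charpoly with hq
  have hq0 : q.coeff 0 ≠ 0 := charpoly_restrict_shift_coeff_zero_ne_zero hshift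
  have hdeg : q.natDegree = s := by rw [hq, LinearMap.charpoly_natDegree, hdim]
  have hqs : q.coeff s = 1 := by
    rw [← hdeg]
    exact (LinearMap.charpoly_monic _).coeff_natDegree
  set p : ℕ → ℂ := fun τ => (q.coeff 0)⁻¹ * q.coeff τ with hp
  have hp0 : p 0 = 1 := inv_mul_cancel₀ hq0
  have hps : p s ≠ 0 := by simp [hp, hqs, hq0]
  have hS : S = solutionSpace s p := by
    refine eq_solutionSpace hs (hp0 ▸ one_ne_zero) hps hdim fun x hx t => ?_
    have h := sum_charpoly_coeff_mul_eq_zero hshift hx t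
    rw [hdim, ← hq] at h
    simp only [hp, mul_assoc, ← Finset.mul_sum, h, mul_zero]
  refine ⟨p, ⟨hp0, hps, fun τ hτ => ?_, congrArg _ hS⟩, ?_⟩
  · simp [hp, Polynomial.coeff_eq_zero_of_natDegree_lt (hdeg.trans_lt hτ)]
  · rintro r ⟨hr0, -, hrs, hr⟩
    have hSr : S = solutionSpace s r := SetLike.coe_injective hr
    funext τ
    rcases Nat.lt_or_ge s τ with h | h
    · rw [hrs τ h]
      simp [hp, Polynomial.coeff_eq_zero_of_natDegree_lt (hdeg.trans_lt h)]
    · exact coeff_eq_of_solutionSpace_eq hs hp0 hps hr0 (hS ▸ hdim) (hS.symm.trans hSr) h
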